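/- Let p : [−1,1] → ℝ be continuous with p > 0 everywhere and ∫_{S²} p(ŝ·ŝ') dŝ' = 1 (this value being independent of ŝ). If f : S² → ℝ is continuous and satisfies f(ŝ) = ∫_{S²} p(ŝ·ŝ') f(ŝ') dŝ' for every ŝ ∈ S², then f is constant. (This is the statement that the normalization of the phase function forces the zeroth-order term of the diffusion asymptotics to be independent of direction.) -/

import Mathlib

open MeasureTheory
open scoped RealInnerProductSpace

noncomputable section

abbrev E3 : Type := EuclideanSpace ℝ (Fin 3)

/-- The unit sphere `S²` in `ℝ³`. -/
def S2 : Set E3 := Metric.sphere (0 : E3) 1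

/-- The surface measure on `S²` (two-dimensional Hausdorff measure restricted to the
sphere, of total mass `4π`). -/
def sphMeas : Measure E3 := (μH[(2 : ℝ)]).restrict S2

/-- A reflection carries any point of the sphere to any other, so caps of equal radius have
equal Hausdorff measure; we only need the null case. -/
theorem hausdorffMeasure_cap_eq_zero {d r : ℝ} {a b : E3} (ha : a ∈ S2) (hb : b ∈ S2)
    (h : μH[d] (Metric.ball a r ∩ S2) = 0) : μH[d] (Metric.ball b r ∩ S2) = 0 := by
  have hab : ‖b‖ = ‖a‖ := by
    simp only [S2, mem_sphere_zero_iff_norm] at ha hb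
    rw [ha, hb]
  set φ := Submodule.reflection (Submodule.span ℝ {b - a})ᗮ
  have hφ : φ b = a := Submodule.reflection_sub hab
  rw [← φ.isometry.hausdorffMeasure_image (Or.inr φ.surjective)]
  refine measure_mono_null ?_ h
  rintro _ ⟨x, ⟨hx, hxs⟩, rfl⟩
  refine ⟨?_, ?_⟩
  · rwa [Metric.mem_ball, ← hφ, φ.dist_map]
  · simpa only [S2, mem_sphere_zero_iff_norm, φ.norm_map] using hxs

/-- If the sphere has nonzero Hausdorff measure, then so does every cap. -/
theorem hausdorffMeasure_cap_ne_zero {d r : ℝ} (hr : 0 < r) {a : E3} (ha : a ∈ S2)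
    (hd : μH[d] S2 ≠ 0) : μH[d] (Metric.ball a r ∩ S2) ≠ 0 := fun h =>
  hd <| (isCompact_sphere (0 : E3) 1).measure_zero_of_nhdsWithin fun b hb =>
    ⟨Metric.ball b r ∩ S2, Filter.inter_mem (mem_nhdsWithin_of_mem_nhds (Metric.ball_mem_nhds b hr))
      self_mem_nhdsWithin, hausdorffMeasure_cap_eq_zero ha hb h⟩

/-- **Normalization of the phase function forces the zeroth-order term of the diffusion
asymptotics to be isotropic**: if `p > 0` is a normalized rotationally invariant phase
function and a continuous `f : S² → ℝ` satisfies `f(ŝ) = ∫ p(ŝ·ŝ') f(ŝ') dŝ'` for every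
`ŝ ∈ S²`, then `f` is constant on `S²`. -/
theorem phase_function_fixed_point_constant (p : ℝ → ℝ)
    (hp : ContinuousOn p (Set.Icc (-1) 1))
    (hppos : ∀ t ∈ Set.Icc (-1 : ℝ) 1, 0 < p t)
    (hnorm : ∀ s ∈ S2, (∫ s', p ⟪s, s'⟫ ∂sphMeas) = 1)
    (f : E3 → ℝ) (hf : ContinuousOn f S2)
    (hfix : ∀ s ∈ S2, f s = ∫ s', p ⟪s, s'⟫ * f s' ∂sphMeas) :
    ∀ s₁ ∈ S2, ∀ s₂ ∈ S2, f s₁ = f s₂ := by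
  have hcomp : IsCompact S2 := isCompact_sphere (0 : E3) 1
  have hmeas : MeasurableSet S2 := hcomp.measurableSet
  suffices H : ∃ M, ∀ s ∈ S2, f s = M by
    obtain ⟨M, hM⟩ := H
    intro s₁ h₁ s₂ h₂
    rw [hM s₁ h₁, hM s₂ h₂]
  rcases S2.eq_empty_or_nonempty with hemp | hne
  · exact ⟨0, by simp [hemp]⟩
  obtain ⟨s₀, hs₀, hmax⟩ := hcomp.exists_isMaxOn hne hf
  refine ⟨f s₀, fun s₁ hs₁ => ?_⟩
  have hS2 : μH[(2 : ℝ)] S2 ≠ 0 := fun h => by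
    have h1 := hnorm s₀ hs₀
    rw [sphMeas, Measure.restrict_eq_zero.2 h, integral_zero_measure] at h1
    exact zero_ne_one h1
  have hmem : ∀ s ∈ S2, ⟪s₀, s⟫ ∈ Set.Icc (-1 : ℝ) 1 := fun s hs => by
    simp only [S2, mem_sphere_zero_iff_norm] at hs hs₀
    have := abs_real_inner_le_norm s₀ s
    rw [hs, hs₀, mul_one] at this
    exact abs_le.1 this
  have hpint : Integrable (fun s => p ⟪s₀, s⟫) sphMeas := by
    by_contra h
    have h1 := hnorm s₀ hs₀
    rw [integral_undef h] at h1
    exact zero_ne_one h1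
  obtain ⟨C, hC⟩ := hcomp.exists_bound_of_continuousOn hf
  have hpfint : Integrable (fun s => p ⟪s₀, s⟫ * f s) sphMeas :=
    hpint.mul_bdd (c := C) (hf.aestronglyMeasurable hmeas)
      ((ae_restrict_iff' hmeas).2 (Filter.Eventually.of_forall hC))
  have hint : ∫ s, (p ⟪s₀, s⟫ * f s₀ - p ⟪s₀, s⟫ * f s) ∂sphMeas = 0 := by
    rw [integral_sub (hpint.mul_const _) hpfint, integral_mul_const, hnorm s₀ hs₀, ← hfix s₀ hs₀,
      one_mul, sub_self]
  have hnonneg : 0 ≤ᵐ[sphMeas] fun s => p ⟪s₀, s⟫ * f s₀ - p ⟪s₀, s⟫ * f s := by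
    refine (ae_restrict_iff' hmeas).2 (Filter.Eventually.of_forall fun s hs => ?_)
    exact sub_nonneg.2 (mul_le_mul_of_nonneg_left (hmax hs) (hppos _ (hmem s hs)).le)
  rw [integral_eq_zero_iff_of_nonneg_ae hnonneg ((hpint.mul_const _).sub hpfint)] at hint
  have hae : ∀ᵐ s ∂μH[(2 : ℝ)], s ∈ S2 → f s = f s₀ := by
    filter_upwards [(ae_restrict_iff' hmeas).1 hint] with s h hs
    exact (mul_left_cancel₀ (hppos _ (hmem s hs)).ne' (sub_eq_zero.1 (h hs))).symm
  by_contra hcon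
  obtain ⟨r, hr, hball⟩ := Metric.mem_nhdsWithin_iff.1
    ((hf s₁ hs₁).eventually_ne hcon)
  refine hausdorffMeasure_cap_ne_zero hr hs₁ hS2 (measure_mono_null (fun s hs => ?_) hae)
  exact fun h => hball hs (h hs.2)

end
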